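/- The limit as n tends to infinity of b(n,1)/(n * E(n)) exists and equals pi^2/24 + pi/4 - 1; in other words, for large n, the probability that a vertex chosen uniformly at random from all n * E(n) vertices of all non-plane 1-2 trees on [n] is balanced of rank 1 tends to pi^2/24 + pi/4 - 1. -/

import Mathlib

namespace BalancedTrees

/-- Plane binary trees with vertices labeled by natural numbers;
`nil` is the empty tree, and each child of a vertex is designated
as a left child or a right child. -/
inductive BT where
  | nil : BT
  | node (label : ℕ) (l r : BT) : BT
deriving DecidableEq

namespace BT

/-- `balRank t = some k` if and only if the root of `t` is a balanced vertex of
rank `k`, i.e. every descending path from the root to a leaf has length `k`. -/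
def balRank : BT → Option ℕ
  | .nil => none
  | .node _ .nil .nil => some 0
  | .node _ .nil (.node b rl rr) => (balRank (BT.node b rl rr)).map (· + 1)
  | .node _ (.node a ll lr) .nil => (balRank (BT.node a ll lr)).map (· + 1)
  | .node _ (.node a ll lr) (.node b rl rr) =>
      match balRank (BT.node a ll lr), balRank (BT.node b rl rr) with
      | some i, some j => if i = j then some (i + 1) else none
      | _, _ => none

/-- The number of balanced vertices of rank `k` in the tree `t`. -/
def countBal (k : ℕ) : BT → ℕ
  | .nil => 0
  | .node v l r =>
      countBal k l + countBal k r +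
        (if balRank (BT.node v l r) = some k then 1 else 0)

/-- The number of balanced vertices (of any rank) in the tree `t`. -/
def countBalAll : BT → ℕ
  | .nil => 0
  | .node v l r =>
      countBalAll l + countBalAll r +
        (if (balRank (BT.node v l r)).isSome then 1 else 0)

/-- Auxiliary, fuelled version of `treeOf`. -/
def treeOfAux : ℕ → List ℕ → BT
  | 0, _ => .nil
  | _ + 1, [] => .nil
  | fuel + 1, l =>
      let m := l.foldr max 0
      BT.node m (treeOfAux fuel (l.takeWhile (· != m)))
                (treeOfAux fuel ((l.dropWhile (· != m)).tail))

/-- The decreasing binary tree `T(π)` of a sequence `π` of distinct labels: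
the root is the maximum entry, and its left (resp. right) subtree is built
recursively from the part of the sequence to the left (resp. right) of the
maximum. This is a bijection between permutations of `{1,…,n}` and
decreasing binary trees on `{1,…,n}`. -/
def treeOf (l : List ℕ) : BT := treeOfAux l.length l

/-- Canonical form for non-plane 1-2 trees (as represented by plane trees):
an only child is stored as a left child, and of two (unordered) children the
one with the larger label is stored on the left. Decreasing binary trees in
canonical form are in bijection with non-plane 1-2 trees. -/
def canonNP : BT → Bool
  | .nil => true
  | .node _ l r =>
      canonNP l && canonNP r &&
        (match l, r with
         | .nil, .nil => true
         | .node _ _ _, .nil => true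
         | .nil, .node _ _ _ => false
         | .node a _ _, .node b _ _ => decide (b < a))

/-- Canonical form for plane 1-2 trees: an only child is stored as a left
child (an only child carries no left/right designation), while two children
remain ordered. Decreasing binary trees in canonical form are in bijection
with plane 1-2 trees. -/
def canonP : BT → Bool
  | .nil => true
  | .node _ l r =>
      canonP l && canonP r &&
        (match l, r with
         | .nil, .node _ _ _ => false
         | _, _ => true)

end BT

open BT

/-- The list of all permutations of `{1,…,n}`, each written as a list. -/
def perms (n : ℕ) : List (List ℕ) := (List.range' 1 n).permutations

/-- `a n k`: the total number of balanced vertices of rank `k` over all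
decreasing binary trees on `{1,…,n}`. -/
def a (n k : ℕ) : ℕ := ((perms n).map fun l => countBal k (treeOf l)).sum

/-- `r n k`: the number of decreasing binary trees on `{1,…,n}` whose root is
balanced of rank `k`. -/
def r (n k : ℕ) : ℕ :=
  ((perms n).filter fun l => decide (balRank (treeOf l) = some k)).length

/-- `p n k`: the probability that the root of a uniformly random decreasing
binary tree on `{1,…,n}` is balanced of rank `k`; by convention `p 0 k = 1`. -/
def p (n k : ℕ) : ℚ := if n = 0 then 1 else (r n k : ℚ) / (Nat.factorial n : ℚ)

/-- The number of decreasing binary trees on `{1,…,n}` whose root is balanced. -/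
def rootBal (n : ℕ) : ℕ :=
  ((perms n).filter fun l => (balRank (treeOf l)).isSome).length

/-- `proot n`: the probability that the root of a uniformly random decreasing
binary tree on `{1,…,n}` is balanced. -/
def proot (n : ℕ) : ℚ := (rootBal n : ℚ) / (Nat.factorial n : ℚ)

/-- The total number of balanced vertices over all decreasing binary trees
on `{1,…,n}`. -/
def totalBal (n : ℕ) : ℕ := ((perms n).map fun l => countBalAll (treeOf l)).sum

/-- `Pbal n`: the probability that a vertex chosen uniformly at random from
the `n * n!` vertices of all decreasing binary trees on `{1,…,n}` is balanced. -/
def Pbal (n : ℕ) : ℚ := (totalBal n : ℚ) / ((n : ℚ) * (Nat.factorial n : ℚ))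

/-- Permutations whose decreasing binary tree is a canonical representative
of a non-plane 1-2 tree; these are in bijection with non-plane 1-2 trees
on `{1,…,n}`. -/
def npPerms (n : ℕ) : List (List ℕ) := (perms n).filter fun l => canonNP (treeOf l)

/-- `E n`: the number of non-plane 1-2 trees on `{1,…,n}` (the Euler number). -/
def E (n : ℕ) : ℕ := (npPerms n).length

/-- `b n k`: the total number of balanced vertices of rank `k` over all
non-plane 1-2 trees on `{1,…,n}`. -/
def b (n k : ℕ) : ℕ := ((npPerms n).map fun l => countBal k (treeOf l)).sum

/-- `s n k`: the number of non-plane 1-2 trees on `{1,…,n}` whose root is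
balanced of rank `k`. -/
def s (n k : ℕ) : ℕ :=
  ((npPerms n).filter fun l => decide (balRank (treeOf l) = some k)).length

/-- Permutations whose decreasing binary tree is a canonical representative
of a plane 1-2 tree; these are in bijection with plane 1-2 trees on `{1,…,n}`. -/
def pPerms (n : ℕ) : List (List ℕ) := (perms n).filter fun l => canonP (treeOf l)

/-- `z n`: the number of plane 1-2 trees on `{1,…,n}`. -/
def z (n : ℕ) : ℕ := (pPerms n).length

/-- `d n k`: the total number of balanced vertices of rank `k` over all
plane 1-2 trees on `{1,…,n}`. -/
def d (n k : ℕ) : ℕ := ((pPerms n).map fun l => countBal k (treeOf l)).sum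

/-- `t n k`: the number of plane 1-2 trees on `{1,…,n}` whose root is
balanced of rank `k`. -/
def t (n k : ℕ) : ℕ :=
  ((pPerms n).filter fun l => decide (balRank (treeOf l) = some k)).length

end BalancedTrees
open BalancedTrees

namespace BalancedTrees

namespace BT

theorem foldr_max_mem (l : List ℕ) (hl : l ≠ []) : l.foldr max 0 ∈ l := by
  induction l with
  | nil => exact absurd rfl hl
  | cons x l ih =>
    rcases eq_or_ne l [] with rfl | h
    · simp
    · rw [List.foldr_cons]
      rcases max_choice x (l.foldr max 0) with h' | h' <;> rw [h']
      · exact List.mem_cons_self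
      · exact List.mem_cons_of_mem _ (ih h)

theorem le_foldr_max {l : List ℕ} {x : ℕ} (hx : x ∈ l) : x ≤ l.foldr max 0 := by
  induction l with
  | nil => simp at hx
  | cons y l ih =>
    rw [List.foldr_cons]
    rcases List.mem_cons.1 hx with rfl | h
    · exact le_max_left _ _
    · exact (ih h).trans (le_max_right _ _)

theorem takeWhile_ne_append {l₁ l₂ : List ℕ} {m : ℕ} (h : m ∉ l₁) :
    (l₁ ++ m :: l₂).takeWhile (· != m) = l₁ := by
  induction l₁ with
  | nil => simp
  | cons x l ih =>
    simp only [List.mem_cons, not_or] at h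
    simp [Ne.symm h.1, ih h.2]

theorem dropWhile_ne_append {l₁ l₂ : List ℕ} {m : ℕ} (h : m ∉ l₁) :
    (l₁ ++ m :: l₂).dropWhile (· != m) = m :: l₂ := by
  induction l₁ with
  | nil => simp
  | cons x l ih =>
    simp only [List.mem_cons, not_or] at h
    simp [Ne.symm h.1, ih h.2]

theorem treeOfAux_succ {l : List ℕ} (hl : l ≠ []) (k : ℕ) :
    treeOfAux (k + 1) l = .node (l.foldr max 0)
      (treeOfAux k (l.takeWhile (· != l.foldr max 0)))
      (treeOfAux k ((l.dropWhile (· != l.foldr max 0)).tail)) := by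
  cases l with
  | nil => exact absurd rfl hl
  | cons x l => rfl

theorem treeOfAux_nil (k : ℕ) : treeOfAux k [] = .nil := by cases k <;> rfl

theorem treeOfAux_eq_treeOf {k : ℕ} {l : List ℕ} (h : l.length ≤ k) :
    treeOfAux k l = treeOf l := by
  suffices H : ∀ (i j : ℕ) (l : List ℕ), l.length ≤ i → l.length ≤ j →
      treeOfAux i l = treeOfAux j l from H _ _ _ h le_rfl
  intro i
  induction i with
  | zero =>
    intro j l hi _
    rw [List.length_eq_zero_iff.1 (Nat.le_zero.1 hi), treeOfAux_nil, treeOfAux_nil]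
  | succ i ih =>
    intro j l hi hj
    rcases eq_or_ne l [] with rfl | hl
    · rw [treeOfAux_nil, treeOfAux_nil]
    · obtain ⟨l₁, l₂, hl', hm⟩ := List.eq_append_cons_of_mem (foldr_max_mem l hl)
      obtain ⟨j, rfl⟩ : ∃ j', j = j' + 1 :=
        Nat.exists_eq_succ_of_ne_zero fun h => hl (List.length_eq_zero_iff.1 (by omega))
      rw [treeOfAux_succ hl, treeOfAux_succ hl]
      generalize l.foldr max 0 = m at hl' hm
      subst hl'
      simp only [List.length_append, List.length_cons] at hi hj
      rw [takeWhile_ne_append hm, dropWhile_ne_append hm, List.tail_cons,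
        ih j l₁ (by omega) (by omega), ih j l₂ (by omega) (by omega)]

theorem exists_treeOf_eq_node {l : List ℕ} (hl : l ≠ []) :
    ∃ l₁ m l₂, l = l₁ ++ m :: l₂ ∧ (∀ x ∈ l, x ≤ m) ∧ m ∉ l₁ ∧
      treeOf l = .node m (treeOf l₁) (treeOf l₂) := by
  obtain ⟨l₁, l₂, hl', hm⟩ := List.eq_append_cons_of_mem (foldr_max_mem l hl)
  refine ⟨l₁, _, l₂, hl', fun x hx => le_foldr_max hx, hm, ?_⟩
  obtain ⟨k, hk⟩ : ∃ k, l.length = k + 1 :=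
    Nat.exists_eq_succ_of_ne_zero fun h => hl (List.length_eq_zero_iff.1 h)
  rw [treeOf, hk, treeOfAux_succ hl]
  generalize l.foldr max 0 = m at hl' hm
  subst hl'
  simp only [List.length_append, List.length_cons] at hk
  rw [takeWhile_ne_append hm, dropWhile_ne_append hm, List.tail_cons,
    treeOfAux_eq_treeOf (by omega), treeOfAux_eq_treeOf (by omega)]

theorem append_cons_inj {l₁ l₂ l₁' l₂' : List ℕ} {m : ℕ} (h : m ∉ l₁) (h' : m ∉ l₁')
    (heq : l₁ ++ m :: l₂ = l₁' ++ m :: l₂') : l₁ = l₁' ∧ l₂ = l₂' := by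
  have h1 := congrArg (List.takeWhile (· != m)) heq
  have h2 := congrArg (List.dropWhile (· != m)) heq
  rw [takeWhile_ne_append h, takeWhile_ne_append h'] at h1
  rw [dropWhile_ne_append h, dropWhile_ne_append h'] at h2
  exact ⟨h1, (List.cons.inj h2).2⟩

theorem treeOf_append_cons {l₁ l₂ : List ℕ} {m : ℕ} (h₁ : ∀ x ∈ l₁, x < m)
    (h₂ : ∀ x ∈ l₂, x < m) :
    treeOf (l₁ ++ m :: l₂) = .node m (treeOf l₁) (treeOf l₂) := by
  obtain ⟨k₁, m', k₂, heq, hle, hmem, ht⟩ :=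
    exists_treeOf_eq_node (l := l₁ ++ m :: l₂) (by simp)
  have hm : m' = m := by
    refine le_antisymm ?_ (hle m (by simp))
    have : m' ∈ l₁ ++ m :: l₂ := by rw [heq]; simp
    rcases List.mem_append.1 this with h | h
    · exact (h₁ _ h).le
    · rcases List.mem_cons.1 h with h | h
      · exact h.le
      · exact (h₂ _ h).le
  subst hm
  obtain ⟨rfl, rfl⟩ := append_cons_inj (fun h => lt_irrefl _ (h₁ _ h)) hmem heq
  exact ht

theorem treeOf_nil : treeOf [] = .nil := rfl

theorem exists_treeOf_eq_node_of_max_mem {l : List ℕ} {m : ℕ} (hm : m ∈ l)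
    (hle : ∀ x ∈ l, x ≤ m) : ∃ t₁ t₂, treeOf l = .node m t₁ t₂ := by
  obtain ⟨l₁, m', l₂, heq, hle', -, ht⟩ := exists_treeOf_eq_node (List.ne_nil_of_mem hm)
  have : m' = m := le_antisymm (hle _ (by rw [heq]; simp)) (hle' _ hm)
  exact ⟨_, _, this ▸ ht⟩

theorem treeOf_eq_nil_iff {l : List ℕ} : treeOf l = .nil ↔ l = [] := by
  refine ⟨fun h => ?_, fun h => h ▸ rfl⟩
  by_contra hl
  obtain ⟨_, _, _, -, -, -, ht⟩ := exists_treeOf_eq_node hl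
  rw [ht] at h
  cases h

theorem canonNP_node (m : ℕ) (t₁ t₂ : BT) :
    canonNP (.node m t₁ t₂) = (canonNP t₁ && canonNP t₂ &&
      (match t₁, t₂ with
       | .nil, .nil => true
       | .node _ _ _, .nil => true
       | .nil, .node _ _ _ => false
       | .node x _ _, .node y _ _ => decide (y < x))) := by
  rw [canonNP.eq_def]

theorem balRank_treeOf_eq_zero_iff {l : List ℕ} :
    balRank (treeOf l) = some 0 ↔ l.length = 1 := by
  rcases eq_or_ne l [] with rfl | hl
  · simp [treeOf_nil, balRank]
  obtain ⟨l₁, m, l₂, heq, -, -, ht⟩ := exists_treeOf_eq_node hl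
  have : l.length = 1 ↔ treeOf l₁ = .nil ∧ treeOf l₂ = .nil := by
    rw [treeOf_eq_nil_iff, treeOf_eq_nil_iff, heq, ← List.length_eq_zero_iff,
      ← List.length_eq_zero_iff, List.length_append, List.length_cons]
    omega
  rw [this, ht]
  generalize treeOf l₁ = t₁
  generalize treeOf l₂ = t₂
  rcases t₁ with _ | ⟨x, u, v⟩ <;> rcases t₂ with _ | ⟨y, u', v'⟩ <;> simp only [balRank]
  · simp
  · simp
  · simp
  · rcases balRank (.node x u v) with _ | i <;> rcases balRank (.node y u' v') with _ | j <;> simp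

theorem balRank_node_eq_one_iff {m : ℕ} {t₁ t₂ : BT} (h : t₁ ≠ .nil) :
    balRank (.node m t₁ t₂) = some 1 ↔
      balRank t₁ = some 0 ∧ (t₂ = .nil ∨ balRank t₂ = some 0) := by
  rcases t₁ with _ | ⟨x, u, v⟩
  · exact absurd rfl h
  rcases t₂ with _ | ⟨y, u', v'⟩ <;> simp only [balRank]
  · simp
  · rcases balRank (.node x u v) with _ | i <;> rcases balRank (.node y u' v') with _ | j <;>
      simp
    constructor <;> rintro ⟨rfl, rfl⟩ <;> simp

end BT

open BT

/-- The orderings of `A`, as lists without repetition, whose decreasing binary tree is canonical. -/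
noncomputable def canonOrderings (A : Finset ℕ) : Finset (List ℕ) :=
  A.toList.permutations.toFinset.filter fun l => canonNP (treeOf l)

theorem mem_canonOrderings {A : Finset ℕ} {l : List ℕ} :
    l ∈ canonOrderings A ↔ (l.Nodup ∧ l.toFinset = A) ∧ canonNP (treeOf l) = true := by
  rw [canonOrderings, Finset.mem_filter, List.mem_toFinset, List.mem_permutations]
  refine and_congr_left fun _ => ⟨fun h => ?_, fun ⟨h, hA⟩ => ?_⟩
  · exact ⟨h.nodup_iff.2 A.nodup_toList, by
      rw [List.toFinset_eq_of_perm _ _ h, Finset.toList_toFinset]⟩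
  · rw [← hA]
    exact (List.perm_ext_iff_of_nodup h (Finset.nodup_toList _)).2 fun x => by simp

theorem length_of_mem_canonOrderings {A : Finset ℕ} {l : List ℕ} (h : l ∈ canonOrderings A) :
    l.length = A.card := by
  obtain ⟨⟨hn, rfl⟩, -⟩ := mem_canonOrderings.1 h
  exact (List.toFinset_card_of_nodup hn).symm

theorem sum_canonOrderings_insert_insert {M : Type*} [AddCommMonoid M] {A : Finset ℕ}
    {m m' : ℕ} (hA : ∀ x ∈ A, x < m') (hm : m' < m) (g : List ℕ → M) :
    ∑ l ∈ canonOrderings (insert m (insert m' A)), g l =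
      ∑ S ∈ A.powerset, ∑ q ∈ canonOrderings (insert m' S) ×ˢ canonOrderings (A \ S),
        g (q.1 ++ m :: q.2) := by
  rw [Finset.sum_sigma']
  have hA' : ∀ x ∈ A, x < m := fun x hx => (hA x hx).trans hm
  have hmA : m ∉ A := fun h => lt_irrefl _ (hA' m h)
  have hm'A : m' ∉ A := fun h => lt_irrefl _ (hA m' h)
  have key : ∀ {S : Finset ℕ} {l₁ l₂ : List ℕ}, S ⊆ A → l₁ ∈ canonOrderings (insert m' S) →
      l₂ ∈ canonOrderings (A \ S) → (∀ x ∈ l₁, x ≤ m') ∧ ∀ x ∈ l₂, x < m' := by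
    intro S l₁ l₂ hS h₁ h₂
    obtain ⟨⟨-, e₁⟩, -⟩ := mem_canonOrderings.1 h₁
    obtain ⟨⟨-, e₂⟩, -⟩ := mem_canonOrderings.1 h₂
    refine ⟨fun x hx => ?_, fun x hx => ?_⟩
    · rw [← List.mem_toFinset, e₁, Finset.mem_insert] at hx
      rcases hx with rfl | hx
      · exact le_rfl
      · exact (hA x (hS hx)).le
    · rw [← List.mem_toFinset, e₂, Finset.mem_sdiff] at hx
      exact hA x hx.1
  symm
  refine Finset.sum_bij (fun q _ => q.2.1 ++ m :: q.2.2) ?_ ?_ ?_ (fun _ _ => rfl)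
  · rintro ⟨S, l₁, l₂⟩ hq
    simp only [Finset.mem_sigma, Finset.mem_powerset, Finset.mem_product] at hq ⊢
    obtain ⟨hS, h₁, h₂⟩ := hq
    obtain ⟨k₁, k₂⟩ := key hS h₁ h₂
    obtain ⟨⟨n₁, e₁⟩, c₁⟩ := mem_canonOrderings.1 h₁
    obtain ⟨⟨n₂, e₂⟩, c₂⟩ := mem_canonOrderings.1 h₂
    rw [mem_canonOrderings]
    refine ⟨⟨?_, ?_⟩, ?_⟩
    · rw [List.nodup_append, List.nodup_cons]
      refine ⟨n₁, ⟨fun h => (k₂ _ h).not_gt hm, n₂⟩, ?_⟩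
      rintro x hx y hy rfl
      rcases List.mem_cons.1 hy with rfl | hy
      · exact (k₁ _ hx).not_gt hm
      · rw [← List.mem_toFinset, e₁, Finset.mem_insert] at hx
        have := k₂ _ hy
        rw [← List.mem_toFinset, e₂, Finset.mem_sdiff] at hy
        rcases hx with rfl | hx
        · exact lt_irrefl _ this
        · exact hy.2 hx
    · rw [List.toFinset_append, List.toFinset_cons, e₁, e₂]
      ext x
      have := @hS x
      simp only [Finset.mem_union, Finset.mem_insert, Finset.mem_sdiff]
      tauto
    · rw [treeOf_append_cons (fun x hx => (k₁ x hx).trans_lt hm) fun x hx => (k₂ x hx).trans hm]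
      obtain ⟨t₁, t₂, ht⟩ := exists_treeOf_eq_node_of_max_mem (l := l₁) (m := m')
        (by rw [← List.mem_toFinset, e₁]; exact Finset.mem_insert_self _ _) k₁
      rw [canonNP_node, c₁, c₂, ht]
      rcases eq_or_ne l₂ [] with rfl | hl
      · rw [treeOf_nil]; rfl
      · obtain ⟨r₁, y, r₂, heq, -, -, ht'⟩ := exists_treeOf_eq_node hl
        rw [ht']
        simpa using k₂ y (by rw [heq]; simp)
  · rintro ⟨S, l₁, l₂⟩ hq ⟨S', l₁', l₂'⟩ hq' heq
    simp only [Finset.mem_sigma, Finset.mem_powerset, Finset.mem_product] at hq hq' heq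
    obtain ⟨rfl, rfl⟩ := append_cons_inj
      (fun h => ((key hq.1 hq.2.1 hq.2.2).1 _ h).not_gt hm)
      (fun h => ((key hq'.1 hq'.2.1 hq'.2.2).1 _ h).not_gt hm) heq
    obtain ⟨⟨-, e₁⟩, -⟩ := mem_canonOrderings.1 hq.2.1
    obtain ⟨⟨-, e₁'⟩, -⟩ := mem_canonOrderings.1 hq'.2.1
    have : S = S' := by
      rw [← Finset.erase_insert (fun h => hm'A (hq.1 h)), ← e₁, e₁',
        Finset.erase_insert (fun h => hm'A (hq'.1 h))]
    rw [this]
  · intro l hl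
    obtain ⟨⟨hn, he⟩, hc⟩ := mem_canonOrderings.1 hl
    have hml : m ∈ l := by rw [← List.mem_toFinset, he]; simp
    obtain ⟨l₁, l₂, rfl, hm₁⟩ := List.eq_append_cons_of_mem hml
    rw [List.nodup_append, List.nodup_cons] at hn
    obtain ⟨n₁, ⟨hm₂, n₂⟩, hd⟩ := hn
    have mem_iff : ∀ x, (x ∈ l₁ ∨ x ∈ l₂) ↔ x = m' ∨ x ∈ A := by
      intro x
      have := congrArg (x ∈ ·) he
      simp only [List.mem_toFinset, List.mem_append, List.mem_cons, Finset.mem_insert,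
        eq_iff_iff] at this
      by_cases hx : x = m
      · subst hx
        simp [hm₁, hm₂, hmA, hm.ne']
      · tauto
    have le₁ : ∀ x ∈ l₁, x ≤ m' := fun x hx =>
      ((mem_iff x).1 (Or.inl hx)).elim le_of_eq fun h => (hA x h).le
    have le₂ : ∀ x ∈ l₂, x ≤ m' := fun x hx =>
      ((mem_iff x).1 (Or.inr hx)).elim le_of_eq fun h => (hA x h).le
    rw [treeOf_append_cons (fun x hx => (le₁ x hx).trans_lt hm)
      fun x hx => (le₂ x hx).trans_lt hm, canonNP_node, Bool.and_eq_true, Bool.and_eq_true] at hc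
    obtain ⟨⟨c₁, c₂⟩, hc⟩ := hc
    have hm'₁ : m' ∈ l₁ := by
      by_contra hcon
      have hm'₂ : m' ∈ l₂ := ((mem_iff m').2 (Or.inl rfl)).resolve_left hcon
      obtain ⟨t₁, t₂, ht⟩ := exists_treeOf_eq_node_of_max_mem hm'₂ le₂
      rw [ht] at hc
      rcases eq_or_ne l₁ [] with rfl | hl₁
      · rw [treeOf_nil] at hc
        simp at hc
      · obtain ⟨r₁, y, r₂, heq, -, -, ht'⟩ := exists_treeOf_eq_node hl₁
        rw [ht'] at hc
        have := le₁ y (by rw [heq]; simp)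
        simp only [decide_eq_true_eq] at hc
        omega
    have hS : l₁.toFinset.erase m' ⊆ A := by
      intro x hx
      rw [Finset.mem_erase, List.mem_toFinset] at hx
      exact ((mem_iff x).1 (Or.inl hx.2)).resolve_left hx.1
    refine ⟨⟨l₁.toFinset.erase m', l₁, l₂⟩, ?_, rfl⟩
    simp only [Finset.mem_sigma, Finset.mem_powerset, Finset.mem_product, mem_canonOrderings]
    refine ⟨hS, ⟨⟨n₁, ?_⟩, c₁⟩, ⟨n₂, ?_⟩, c₂⟩
    · rw [Finset.insert_erase (by simpa using hm'₁)]
    · ext x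
      have h := mem_iff x
      have hx := fun h1 h2 => hd x h1 x (List.mem_cons_of_mem _ h2) rfl
      rw [List.mem_toFinset, Finset.mem_sdiff, Finset.mem_erase, List.mem_toFinset]
      by_cases hxm : x = m'
      · subst hxm
        simp only [hm'A, false_and, iff_false]
        exact hx hm'₁
      · tauto

theorem canonOrderings_empty : canonOrderings ∅ = {[]} := by
  ext l
  rw [mem_canonOrderings, List.toFinset_eq_empty_iff, Finset.mem_singleton]
  refine ⟨fun h => h.1.2, ?_⟩
  rintro rfl
  exact ⟨⟨List.nodup_nil, rfl⟩, rfl⟩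

theorem canonOrderings_singleton (m : ℕ) : canonOrderings {m} = {[m]} := by
  ext l
  rw [Finset.mem_singleton]
  refine ⟨fun h => ?_, ?_⟩
  · obtain ⟨x, rfl⟩ := List.length_eq_one_iff.1 (length_of_mem_canonOrderings h)
    simpa using (mem_canonOrderings.1 h).1.2
  · rintro rfl
    refine mem_canonOrderings.2 ⟨by simp, ?_⟩
    rw [← List.nil_append [m], treeOf_append_cons (by simp) (by simp)]
    rfl

theorem exists_eq_insert_insert {A : Finset ℕ} {n : ℕ} (h : A.card = n + 2) :
    ∃ (B : Finset ℕ) (m m' : ℕ), A = insert m (insert m' B) ∧ B.card = n ∧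
      (∀ x ∈ B, x < m') ∧ m' < m := by
  have step : ∀ {C : Finset ℕ} {k : ℕ}, C.card = k + 1 →
      ∃ (D : Finset ℕ) (m : ℕ), C = insert m D ∧ D.card = k ∧ ∀ x ∈ D, x < m := by
    intro C k hC
    have hne : C.Nonempty := Finset.card_pos.1 (by omega)
    refine ⟨C.erase (C.max' hne), C.max' hne, (Finset.insert_erase (C.max'_mem hne)).symm, ?_,
      fun x hx => Finset.lt_max'_of_mem_erase_max' C hne hx⟩
    rw [Finset.card_erase_of_mem (C.max'_mem hne), hC, Nat.add_sub_cancel]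
  obtain ⟨D, m, rfl, hD, hlt⟩ := step h
  obtain ⟨B, m', rfl, hB, hlt'⟩ := step hD
  exact ⟨B, m, m', rfl, hB, hlt', hlt m' (Finset.mem_insert_self _ _)⟩

/-- The number of canonical orderings of `A`. -/
noncomputable def canonCard (A : Finset ℕ) : ℕ := (canonOrderings A).card

/-- The total number of balanced vertices of rank `1` over the trees of the canonical orderings
of `A`. -/
noncomputable def canonBal (A : Finset ℕ) : ℕ := ∑ l ∈ canonOrderings A, countBal 1 (treeOf l)

theorem canonCard_insert_insert {A : Finset ℕ} {m m' : ℕ} (hA : ∀ x ∈ A, x < m')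
    (hm : m' < m) : canonCard (insert m (insert m' A)) =
      ∑ S ∈ A.powerset, canonCard (insert m' S) * canonCard (A \ S) := by
  rw [canonCard, Finset.card_eq_sum_ones, sum_canonOrderings_insert_insert hA hm]
  refine Finset.sum_congr rfl fun S _ => ?_
  rw [← Finset.card_eq_sum_ones, Finset.card_product]
  rfl

theorem canonBal_insert_insert {A : Finset ℕ} {m m' : ℕ} (hA : ∀ x ∈ A, x < m')
    (hm : m' < m) : canonBal (insert m (insert m' A)) =
      ∑ S ∈ A.powerset, (canonBal (insert m' S) * canonCard (A \ S) +
        canonCard (insert m' S) * canonBal (A \ S) +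
        if S.card = 0 ∧ (A \ S).card ≤ 1 then
          canonCard (insert m' S) * canonCard (A \ S) else 0) := by
  rw [canonBal, sum_canonOrderings_insert_insert hA hm]
  refine Finset.sum_congr rfl fun S hS => ?_
  have hS : S ⊆ A := Finset.mem_powerset.1 hS
  have hm'S : m' ∉ S := fun h => lt_irrefl _ (hA m' (hS h))
  have key : ∀ q ∈ canonOrderings (insert m' S) ×ˢ canonOrderings (A \ S),
      countBal 1 (treeOf (q.1 ++ m :: q.2)) = countBal 1 (treeOf q.1) + countBal 1 (treeOf q.2) +
        if S.card = 0 ∧ (A \ S).card ≤ 1 then 1 else 0 := by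
    rintro ⟨l₁, l₂⟩ hq
    obtain ⟨h₁, h₂⟩ := Finset.mem_product.1 hq
    have len₁ := length_of_mem_canonOrderings h₁
    have len₂ := length_of_mem_canonOrderings h₂
    rw [Finset.card_insert_of_notMem hm'S] at len₁
    obtain ⟨⟨-, e₁⟩, -⟩ := mem_canonOrderings.1 h₁
    obtain ⟨⟨-, e₂⟩, -⟩ := mem_canonOrderings.1 h₂
    dsimp only at e₁ e₂ len₁ len₂ ⊢
    rw [treeOf_append_cons, countBal]
    · congr 1
      refine if_congr ?_ rfl rfl
      have hne : treeOf l₁ ≠ .nil := fun h => by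
        rw [treeOf_eq_nil_iff.1 h] at len₁
        simp at len₁
      rw [balRank_node_eq_one_iff hne, balRank_treeOf_eq_zero_iff, balRank_treeOf_eq_zero_iff,
        treeOf_eq_nil_iff, ← List.length_eq_zero_iff, len₁, len₂]
      omega
    · intro x hx
      rw [← List.mem_toFinset, e₁, Finset.mem_insert] at hx
      rcases hx with rfl | hx
      · exact hm
      · exact (hA x (hS hx)).trans hm
    · intro x hx
      rw [← List.mem_toFinset, e₂, Finset.mem_sdiff] at hx
      exact (hA x hx.1).trans hm
  rw [Finset.sum_congr rfl key, Finset.sum_add_distrib, Finset.sum_add_distrib,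
    Finset.sum_product, Finset.sum_product, Finset.sum_const, Finset.card_product]
  simp only [Finset.sum_const, smul_eq_mul, ← Finset.mul_sum, canonBal, canonCard]
  congr 1
  · congr 1
    exact mul_comm _ _
  · split_ifs <;> simp

theorem sum_powerset_card_sdiff (A : Finset ℕ) (g : ℕ → ℕ → ℕ) :
    ∑ S ∈ A.powerset, g S.card (A \ S).card =
      ∑ k ∈ Finset.range (A.card + 1), A.card.choose k * g k (A.card - k) := by
  have := Finset.sum_powerset_apply_card (fun k => g k (A.card - k)) (x := A)
  simp only [smul_eq_mul] at this
  rw [← this]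
  refine Finset.sum_congr rfl fun S hS => ?_
  rw [Finset.card_sdiff_of_subset (Finset.mem_powerset.1 hS)]

theorem canonCard_congr {A B : Finset ℕ} (h : A.card = B.card) : canonCard A = canonCard B := by
  suffices H : ∀ n, ∃ c, ∀ A : Finset ℕ, A.card = n → canonCard A = c by
    obtain ⟨c, hc⟩ := H B.card
    rw [hc A h, hc B rfl]
  intro n
  induction n using Nat.strong_induction_on with
  | _ n ih =>
  match n, ih with
  | 0, _ => exact ⟨1, fun A hA => by
      rw [Finset.card_eq_zero.1 hA, canonCard, canonOrderings_empty, Finset.card_singleton]⟩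
  | 1, _ => exact ⟨1, fun A hA => by
      obtain ⟨m, rfl⟩ := Finset.card_eq_one.1 hA
      rw [canonCard, canonOrderings_singleton, Finset.card_singleton]⟩
  | n + 2, ih =>
    choose! c hc using ih
    refine ⟨∑ k ∈ Finset.range (n + 1), n.choose k * (c (k + 1) * c (n - k)), fun A hA => ?_⟩
    obtain ⟨A, m, m', rfl, rfl, hlt, hm⟩ := exists_eq_insert_insert hA
    rw [canonCard_insert_insert hlt hm, ← sum_powerset_card_sdiff A fun i j => c (i + 1) * c j]
    refine Finset.sum_congr rfl fun S hS => ?_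
    have hS := Finset.mem_powerset.1 hS
    have hle := Finset.card_le_card hS
    have hle' := Finset.card_le_card (Finset.sdiff_subset (s := A) (t := S))
    have hm'S : m' ∉ S := fun h => lt_irrefl _ (hlt m' (hS h))
    rw [hc (S.card + 1) (by omega) _ (Finset.card_insert_of_notMem hm'S),
      hc (A \ S).card (by omega) _ rfl]

theorem canonBal_congr {A B : Finset ℕ} (h : A.card = B.card) : canonBal A = canonBal B := by
  suffices H : ∀ n, ∃ c, ∀ A : Finset ℕ, A.card = n → canonBal A = c by
    obtain ⟨c, hc⟩ := H B.card
    rw [hc A h, hc B rfl]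
  intro n
  induction n using Nat.strong_induction_on with
  | _ n ih =>
  match n, ih with
  | 0, _ => exact ⟨_, fun A hA => by rw [Finset.card_eq_zero.1 hA]⟩
  | 1, _ => exact ⟨0, fun A hA => by
      obtain ⟨m, rfl⟩ := Finset.card_eq_one.1 hA
      rw [canonBal, canonOrderings_singleton, Finset.sum_singleton, ← List.nil_append [m],
        treeOf_append_cons (by simp) (by simp)]
      rfl⟩
  | n + 2, ih =>
    choose! c hc using ih
    let e : ℕ → ℕ := fun k => canonCard (Finset.range k)
    refine ⟨∑ k ∈ Finset.range (n + 1), n.choose k * (c (k + 1) * e (n - k) +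
      e (k + 1) * c (n - k) + if k = 0 ∧ n - k ≤ 1 then e (k + 1) * e (n - k) else 0),
      fun A hA => ?_⟩
    obtain ⟨A, m, m', rfl, rfl, hlt, hm⟩ := exists_eq_insert_insert hA
    rw [canonBal_insert_insert hlt hm, ← sum_powerset_card_sdiff A fun i j =>
      c (i + 1) * e j + e (i + 1) * c j + if i = 0 ∧ j ≤ 1 then e (i + 1) * e j else 0]
    refine Finset.sum_congr rfl fun S hS => ?_
    have hS := Finset.mem_powerset.1 hS
    have hle := Finset.card_le_card hS
    have hle' := Finset.card_le_card (Finset.sdiff_subset (s := A) (t := S))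
    have hm'S : m' ∉ S := fun h => lt_irrefl _ (hlt m' (hS h))
    have e₁ : canonCard (insert m' S) = e (S.card + 1) := canonCard_congr (by
      rw [Finset.card_insert_of_notMem hm'S, Finset.card_range])
    have e₂ : canonCard (A \ S) = e (A \ S).card := canonCard_congr (by
      rw [Finset.card_range])
    rw [hc (S.card + 1) (by omega) _ (Finset.card_insert_of_notMem hm'S),
      hc (A \ S).card (by omega) _ rfl, e₁, e₂]

theorem nodup_npPerms (n : ℕ) : (npPerms n).Nodup :=
  (List.nodup_permutations _ List.nodup_range').filter _

theorem toFinset_npPerms (n : ℕ) : (npPerms n).toFinset = canonOrderings (Finset.Icc 1 n) := by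
  ext l
  rw [List.mem_toFinset, npPerms, List.mem_filter, mem_canonOrderings, perms,
    List.mem_permutations]
  refine and_congr_left fun _ => ?_
  have hr : (List.range' 1 n).toFinset = Finset.Icc 1 n := by
    ext x
    simp [List.mem_range'_1]
    omega
  refine ⟨fun h => ⟨h.nodup_iff.2 List.nodup_range', ?_⟩, fun ⟨h, h'⟩ => ?_⟩
  · rw [List.toFinset_eq_of_perm _ _ h, hr]
  · rw [← hr] at h'
    exact (List.perm_ext_iff_of_nodup h List.nodup_range').2 fun x => by
      rw [← List.mem_toFinset, h', List.mem_toFinset]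

theorem E_eq_canonCard (A : Finset ℕ) : E A.card = canonCard A := by
  rw [E, ← List.toFinset_card_of_nodup (nodup_npPerms _), toFinset_npPerms]
  exact canonCard_congr (by simp)

theorem b_eq_canonBal (A : Finset ℕ) : b A.card 1 = canonBal A := by
  rw [b, ← List.sum_toFinset _ (nodup_npPerms _), toFinset_npPerms]
  exact canonBal_congr (by simp)

theorem E_zero : E 0 = 1 := by
  rw [← Finset.card_empty (α := ℕ), E_eq_canonCard, canonCard, canonOrderings_empty,
    Finset.card_singleton]

theorem E_one : E 1 = 1 := by
  have h := E_eq_canonCard {0}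
  rwa [canonCard, canonOrderings_singleton, Finset.card_singleton, Finset.card_singleton] at h

theorem b_zero : b 0 1 = 0 := by
  rw [← Finset.card_empty (α := ℕ), b_eq_canonBal, canonBal, canonOrderings_empty,
    Finset.sum_singleton]
  rfl

theorem b_one : b 1 1 = 0 := by
  have h := b_eq_canonBal {0}
  rwa [canonBal, canonOrderings_singleton, Finset.sum_singleton, ← List.nil_append [0],
    treeOf_append_cons (by simp) (by simp), Finset.card_singleton] at h

theorem E_add_two (n : ℕ) :
    E (n + 2) = ∑ k ∈ Finset.range (n + 1), n.choose k * (E (k + 1) * E (n - k)) := by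
  obtain ⟨A, m, m', h, hA, hlt, hm⟩ := exists_eq_insert_insert (Finset.card_range (n + 2))
  rw [← Finset.card_range (n + 2), E_eq_canonCard, h, canonCard_insert_insert hlt hm, ← hA,
    ← sum_powerset_card_sdiff A fun i j => E (i + 1) * E j]
  refine Finset.sum_congr rfl fun S hS => ?_
  have hm'S : m' ∉ S := fun h => lt_irrefl _ (hlt m' (Finset.mem_powerset.1 hS h))
  rw [← Finset.card_insert_of_notMem hm'S, E_eq_canonCard, E_eq_canonCard]

theorem b_add_two (n : ℕ) :
    b (n + 2) 1 = ∑ k ∈ Finset.range (n + 1), n.choose k * (b (k + 1) 1 * E (n - k)) +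
      ∑ k ∈ Finset.range (n + 1), n.choose k * (E (k + 1) * b (n - k) 1) +
      if n ≤ 1 then 1 else 0 := by
  obtain ⟨A, m, m', h, hA, hlt, hm⟩ := exists_eq_insert_insert (Finset.card_range (n + 2))
  have hb : b (n + 2) 1 = ∑ k ∈ Finset.range (n + 1), n.choose k * (b (k + 1) 1 * E (n - k) +
      E (k + 1) * b (n - k) 1 + if k = 0 ∧ n - k ≤ 1 then E (k + 1) * E (n - k) else 0) := by
    rw [← Finset.card_range (n + 2), b_eq_canonBal, h, canonBal_insert_insert hlt hm, ← hA,
      ← sum_powerset_card_sdiff A fun i j => b (i + 1) 1 * E j + E (i + 1) * b j 1 +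
        if i = 0 ∧ j ≤ 1 then E (i + 1) * E j else 0]
    refine Finset.sum_congr rfl fun S hS => ?_
    have hm'S : m' ∉ S := fun h => lt_irrefl _ (hlt m' (Finset.mem_powerset.1 hS h))
    rw [← Finset.card_insert_of_notMem hm'S, E_eq_canonCard, E_eq_canonCard, b_eq_canonBal,
      b_eq_canonBal]
  rw [hb]
  simp only [mul_add, Finset.sum_add_distrib]
  congr 1
  rw [Finset.sum_eq_single 0]
  · have : n ≤ 1 → E n = 1 := fun h => by
      interval_cases n
      · exact E_zero
      · exact E_one
    split_ifs <;> simp_all [E_one]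
  · intro k _ hk
    simp [hk]
  · simp

section Analytic

open Filter Topology Complex

/-- The entire function `sin u / u`. -/
noncomputable def sinDiv : ℂ → ℂ := dslope Complex.sin 0

theorem mul_sinDiv (u : ℂ) : u * sinDiv u = Complex.sin u := by
  simpa [sinDiv] using sub_smul_dslope Complex.sin 0 u

theorem sinDiv_zero : sinDiv 0 = 1 := by simp [sinDiv]

theorem differentiable_sinDiv : Differentiable ℂ sinDiv := by
  rw [← differentiableOn_univ]
  exact (Complex.differentiableOn_dslope univ_mem).2 differentiable_sin.differentiableOn

theorem sinDiv_ne_zero {u : ℂ} (hu : ‖u‖ < Real.pi) : sinDiv u ≠ 0 := by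
  intro h
  rcases eq_or_ne u 0 with rfl | hu0
  · simp [sinDiv_zero] at h
  · have hs : Complex.sin u = 0 := by rw [← mul_sinDiv, h, mul_zero]
    obtain ⟨k, rfl⟩ := Complex.sin_eq_zero_iff.1 hs
    have hk : k ≠ 0 := by
      rintro rfl
      simp at hu0
    have h1 : (1 : ℝ) ≤ ‖(k : ℂ)‖ := by
      rw [norm_intCast]
      exact_mod_cast Int.one_le_abs hk
    rw [norm_mul, norm_real, Real.norm_of_nonneg Real.pi_pos.le] at hu
    nlinarith [Real.pi_pos]

/-- The change of variables `π / 4 - z / 2`. -/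
noncomputable def halfAngle (z : ℂ) : ℂ := (Real.pi : ℂ) / 4 - z / 2

theorem hasDerivAt_halfAngle (z : ℂ) : HasDerivAt halfAngle (-(1 / 2)) z :=
  ((hasDerivAt_id z).div_const 2).const_sub ((Real.pi : ℂ) / 4)

theorem differentiable_halfAngle : Differentiable ℂ halfAngle := fun z =>
  (hasDerivAt_halfAngle z).differentiableAt

/-- The exponential generating function of the Euler numbers. -/
noncomputable def eulerFun (z : ℂ) : ℂ := Complex.cos (halfAngle z) / Complex.sin (halfAngle z)

/-- The antiderivative of `(z + z ^ 2 / 2) * (1 - sin z)` vanishing at `0`. -/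
noncomputable def balNum (z : ℂ) : ℂ :=
  z ^ 2 / 2 + z ^ 3 / 6 + z * Complex.cos z - Complex.sin z + z ^ 2 * Complex.cos z / 2 -
    z * Complex.sin z - Complex.cos z + 1

/-- The exponential generating function of the numbers `b n 1`. -/
noncomputable def balFun (z : ℂ) : ℂ := balNum z / (2 * Complex.sin (halfAngle z) ^ 2)

theorem two_mul_sin_halfAngle_sq (z : ℂ) :
    2 * Complex.sin (halfAngle z) ^ 2 = 1 - Complex.sin z := by
  have h : Complex.cos (2 * halfAngle z) = Complex.sin z := by
    rw [halfAngle, ← Complex.cos_pi_div_two_sub]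
    congr 1
    ring
  rw [Complex.cos_two_mul] at h
  linear_combination -h + 2 * Complex.sin_sq_add_cos_sq (halfAngle z)

theorem hasDerivAt_balNum (z : ℂ) :
    HasDerivAt balNum ((z + z ^ 2 / 2) * (1 - Complex.sin z)) z := by
  have h := ((((((((hasDerivAt_pow 2 z).div_const 2).add ((hasDerivAt_pow 3 z).div_const 6)).add
    ((hasDerivAt_id z).mul (Complex.hasDerivAt_cos z))).sub (Complex.hasDerivAt_sin z)).add
    (((hasDerivAt_pow 2 z).mul (Complex.hasDerivAt_cos z)).div_const 2)).sub
    ((hasDerivAt_id z).mul (Complex.hasDerivAt_sin z))).sub (Complex.hasDerivAt_cos z)).add_const 1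
  refine h.congr_deriv ?_
  simp only [id]
  push_cast
  ring

theorem differentiable_balNum : Differentiable ℂ balNum := fun z =>
  (hasDerivAt_balNum z).differentiableAt

theorem hasDerivAt_eulerFun {z : ℂ} (hz : Complex.sin (halfAngle z) ≠ 0) :
    HasDerivAt eulerFun ((1 + eulerFun z ^ 2) / 2) z := by
  have h := ((Complex.hasDerivAt_cos _).comp z (hasDerivAt_halfAngle z)).div
    ((Complex.hasDerivAt_sin _).comp z (hasDerivAt_halfAngle z)) hz
  refine h.congr_deriv ?_
  simp only [eulerFun, Function.comp]
  field_simp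
  ring

theorem hasDerivAt_balFun {z : ℂ} (hz : Complex.sin (halfAngle z) ≠ 0) :
    HasDerivAt balFun (z + z ^ 2 / 2 + balFun z * eulerFun z) z := by
  have h := (hasDerivAt_balNum z).div
    ((((Complex.hasDerivAt_sin _).comp z (hasDerivAt_halfAngle z)).pow 2).const_mul 2)
    (mul_ne_zero two_ne_zero (pow_ne_zero 2 hz))
  refine h.congr_deriv ?_
  simp only [balFun, eulerFun, Function.comp, Pi.pow_apply, ← two_mul_sin_halfAngle_sq]
  field_simp
  ring

theorem sin_halfAngle_zero : Complex.sin (halfAngle 0) = (√2 / 2 : ℝ) := by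
  rw [halfAngle, ← Real.sin_pi_div_four]
  push_cast
  simp

theorem cos_halfAngle_zero : Complex.cos (halfAngle 0) = (√2 / 2 : ℝ) := by
  rw [halfAngle, ← Real.cos_pi_div_four]
  push_cast
  simp

theorem sin_halfAngle_zero_ne : Complex.sin (halfAngle 0) ≠ 0 := by
  rw [sin_halfAngle_zero, Complex.ofReal_ne_zero]
  positivity

theorem eventually_sin_halfAngle_ne : ∀ᶠ z in 𝓝 (0 : ℂ), Complex.sin (halfAngle z) ≠ 0 :=
  (Complex.continuous_sin.comp differentiable_halfAngle.continuous).continuousAt.eventually_ne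
    sin_halfAngle_zero_ne

theorem eulerFun_zero : eulerFun 0 = 1 := by
  have := sin_halfAngle_zero_ne
  rw [eulerFun, cos_halfAngle_zero, ← sin_halfAngle_zero, div_self this]

theorem balFun_zero : balFun 0 = 0 := by
  simp [balFun, balNum]

theorem analyticAt_of_eventually_hasDerivAt {f f' : ℂ → ℂ} {z : ℂ}
    (h : ∀ᶠ w in 𝓝 z, HasDerivAt f (f' w) w) : AnalyticAt ℂ f z :=
  Complex.analyticAt_iff_eventually_differentiableAt.2 (h.mono fun _ h => h.differentiableAt)

theorem eventually_hasDerivAt_eulerFun :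
    ∀ᶠ z in 𝓝 0, HasDerivAt eulerFun ((1 + eulerFun z ^ 2) / 2) z :=
  eventually_sin_halfAngle_ne.mono fun _ => hasDerivAt_eulerFun

theorem eventually_hasDerivAt_balFun :
    ∀ᶠ z in 𝓝 0, HasDerivAt balFun (z + z ^ 2 / 2 + balFun z * eulerFun z) z :=
  eventually_sin_halfAngle_ne.mono fun _ => hasDerivAt_balFun

theorem analyticAt_eulerFun : AnalyticAt ℂ eulerFun 0 :=
  analyticAt_of_eventually_hasDerivAt eventually_hasDerivAt_eulerFun

theorem analyticAt_balFun : AnalyticAt ℂ balFun 0 :=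
  analyticAt_of_eventually_hasDerivAt eventually_hasDerivAt_balFun

theorem deriv_deriv_eulerFun :
    deriv (deriv eulerFun) =ᶠ[𝓝 0] deriv eulerFun * eulerFun := by
  have h : deriv eulerFun =ᶠ[𝓝 0] fun z => (1 + eulerFun z ^ 2) / 2 :=
    eventually_hasDerivAt_eulerFun.mono fun _ h => h.deriv
  filter_upwards [h.eventuallyEq_nhds, eventually_hasDerivAt_eulerFun] with z hz hE
  rw [hz.deriv_eq, Pi.mul_apply, hE.deriv]
  refine (((hE.pow 2).const_add 1).div_const 2).deriv.trans ?_
  push_cast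
  ring

theorem deriv_deriv_balFun :
    deriv (deriv balFun) =ᶠ[𝓝 0]
      (deriv balFun * eulerFun + deriv eulerFun * balFun) + fun z => 1 + z := by
  have h : deriv balFun =ᶠ[𝓝 0] fun z => z + z ^ 2 / 2 + balFun z * eulerFun z :=
    eventually_hasDerivAt_balFun.mono fun _ h => h.deriv
  filter_upwards [h.eventuallyEq_nhds, eventually_hasDerivAt_eulerFun,
    eventually_hasDerivAt_balFun] with z hz hE hB
  rw [hz.deriv_eq]
  simp only [Pi.add_apply, Pi.mul_apply]
  rw [hE.deriv, hB.deriv]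
  refine (((hasDerivAt_id z).add ((hasDerivAt_pow 2 z).div_const 2)).add
    (hB.mul hE)).deriv.trans ?_
  push_cast
  ring

theorem iteratedDeriv_const_add_mul_id (x y : ℂ) (n : ℕ) :
    iteratedDeriv (n + 2) (fun z : ℂ => x + y * z) 0 = 0 := by
  have h1 : deriv (fun z : ℂ => x + y * z) = fun _ => y := by
    ext z
    simp
  have h2 : deriv (fun _ : ℂ => y) = fun _ => 0 := by
    ext z
    simp
  rw [iteratedDeriv_succ', iteratedDeriv_succ', h1, h2, iteratedDeriv_const]
  simp

theorem deriv_const_add_mul_id (x y : ℂ) : deriv (fun z : ℂ => x + y * z) 0 = y := by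
  simp

theorem iteratedDeriv_eulerFun (n : ℕ) : iteratedDeriv n eulerFun 0 = E n := by
  induction n using Nat.strong_induction_on with
  | _ n ih =>
  match n, ih with
  | 0, _ => simp [eulerFun_zero, E_zero]
  | 1, _ =>
    rw [iteratedDeriv_one, eventually_hasDerivAt_eulerFun.self_of_nhds.deriv, eulerFun_zero, E_one]
    norm_num
  | n + 2, ih =>
    rw [iteratedDeriv_succ', iteratedDeriv_succ', deriv_deriv_eulerFun.iteratedDeriv_eq,
      iteratedDeriv_mul analyticAt_eulerFun.deriv.contDiffAt analyticAt_eulerFun.contDiffAt,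
      E_add_two]
    push_cast
    refine Finset.sum_congr rfl fun k hk => ?_
    have := Finset.mem_range.1 hk
    rw [← iteratedDeriv_succ', ih _ (by omega), ih _ (by omega), mul_assoc]

theorem iteratedDeriv_balFun (n : ℕ) : iteratedDeriv n balFun 0 = b n 1 := by
  induction n using Nat.strong_induction_on with
  | _ n ih =>
  match n, ih with
  | 0, _ => simp [balFun_zero, b_zero]
  | 1, _ =>
    rw [iteratedDeriv_one, eventually_hasDerivAt_balFun.self_of_nhds.deriv, balFun_zero, b_one]
    norm_num
  | n + 2, ih =>
    have hE := analyticAt_eulerFun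
    have hB := analyticAt_balFun
    have hL : AnalyticAt ℂ (fun z : ℂ => 1 + z) 0 := by fun_prop
    rw [iteratedDeriv_succ', iteratedDeriv_succ', deriv_deriv_balFun.iteratedDeriv_eq,
      iteratedDeriv_add ((hB.deriv.mul hE).add (hE.deriv.mul hB)).contDiffAt hL.contDiffAt,
      iteratedDeriv_add (hB.deriv.mul hE).contDiffAt (hE.deriv.mul hB).contDiffAt,
      iteratedDeriv_mul hB.deriv.contDiffAt hE.contDiffAt,
      iteratedDeriv_mul hE.deriv.contDiffAt hB.contDiffAt, b_add_two]
    push_cast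
    congr 1
    · congr 1
      · refine Finset.sum_congr rfl fun k hk => ?_
        have := Finset.mem_range.1 hk
        rw [← iteratedDeriv_succ', ih _ (by omega), iteratedDeriv_eulerFun, mul_assoc]
      · refine Finset.sum_congr rfl fun k hk => ?_
        have := Finset.mem_range.1 hk
        rw [← iteratedDeriv_succ', ih _ (by omega), iteratedDeriv_eulerFun, mul_assoc]
    · match n with
      | 0 => simp
      | 1 => simp
      | n + 2 => simpa using iteratedDeriv_const_add_mul_id 1 1 n

/-- The `n`-th term of the Taylor series of `f` at `0`, evaluated at `ρ`. -/
noncomputable def taylorTerm (ρ : ℂ) (f : ℂ → ℂ) (n : ℕ) : ℂ :=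
  (n.factorial : ℂ)⁻¹ * (ρ ^ n * iteratedDeriv n f 0)

theorem sum_taylorTerm_of_eventuallyEq {ρ : ℂ} (hρ : ρ ≠ 0) {f g : ℂ → ℂ}
    (hg : AnalyticAt ℂ g 0) (h : f =ᶠ[𝓝 0] fun z => (1 - z / ρ) * g z) (n : ℕ) :
    ∑ i ∈ Finset.range (n + 1), taylorTerm ρ f i = taylorTerm ρ g n := by
  let L : ℂ → ℂ := fun z => 1 + -ρ⁻¹ * z
  have hL : AnalyticAt ℂ L 0 := by fun_prop
  have hf : f =ᶠ[𝓝 0] L * g := h.trans (Eventually.of_forall fun z => by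
    simp only [L, Pi.mul_apply]
    ring)
  have key : ∀ n, iteratedDeriv (n + 1) f 0 =
      iteratedDeriv (n + 1) g 0 - (n + 1) * ρ⁻¹ * iteratedDeriv n g 0 := by
    intro n
    rw [hf.iteratedDeriv_eq, iteratedDeriv_mul hL.contDiffAt hg.contDiffAt,
      Finset.sum_range_succ', Finset.sum_range_succ', Finset.sum_eq_zero]
    · rw [zero_add, iteratedDeriv_one, deriv_const_add_mul_id]
      simp [L]
      ring
    · intro i _
      rw [iteratedDeriv_const_add_mul_id, mul_zero, zero_mul]
  induction n with
  | zero =>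
    rw [Finset.sum_range_one, taylorTerm, taylorTerm, hf.iteratedDeriv_eq]
    simp [L]
  | succ n ih =>
    rw [Finset.sum_range_succ, ih, taylorTerm, taylorTerm, taylorTerm, key, Nat.factorial_succ]
    have h1 : (n.factorial : ℂ) ≠ 0 := Nat.cast_ne_zero.2 n.factorial_ne_zero
    have h2 : (n + 1 : ℂ) ≠ 0 := Nat.cast_add_one_ne_zero n
    push_cast
    field_simp
    ring

theorem tendsto_sum_taylorTerm {f : ℂ → ℂ} {R : ℝ} (hf : DifferentiableOn ℂ f (Metric.ball 0 R))
    {ρ : ℂ} (hρ : ‖ρ‖ < R) :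
    Tendsto (fun n => ∑ i ∈ Finset.range (n + 1), taylorTerm ρ f i) atTop (𝓝 (f ρ)) := by
  have h := (Complex.hasSum_taylorSeries_on_ball hf (mem_ball_zero_iff.2 hρ)).tendsto_sum_nat
  simpa [taylorTerm, Function.comp_def] using h.comp (tendsto_add_atTop_nat 1)

theorem sinDiv_halfAngle_ne_zero {z : ℂ} (hz : z ∈ Metric.ball (0 : ℂ) 2) :
    sinDiv (halfAngle z) ≠ 0 := by
  refine sinDiv_ne_zero ((norm_sub_le _ _).trans_lt ?_)
  rw [mem_ball_zero_iff] at hz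
  rw [norm_div, norm_div, norm_real, Real.norm_of_nonneg Real.pi_pos.le]
  norm_num
  linarith [Real.pi_gt_three]

/-- The dominant singularity of `eulerFun`. -/
noncomputable def piHalf : ℂ := (Real.pi : ℂ) / 2

theorem piHalf_ne_zero : piHalf ≠ 0 := by
  simp [piHalf, Real.pi_ne_zero]

theorem norm_piHalf_lt : ‖piHalf‖ < 2 := by
  rw [piHalf, norm_div, norm_real, Real.norm_of_nonneg Real.pi_pos.le]
  norm_num
  linarith [Real.pi_lt_d2]

theorem halfAngle_piHalf : halfAngle piHalf = 0 := by
  rw [halfAngle, piHalf]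
  ring

theorem one_sub_div_piHalf (z : ℂ) : 1 - z / piHalf = 4 / Real.pi * halfAngle z := by
  have := Complex.ofReal_ne_zero.2 Real.pi_ne_zero
  rw [halfAngle, piHalf]
  field_simp
  ring

theorem halfAngle_ne_zero_of_sin_ne_zero {z : ℂ} (hz : Complex.sin (halfAngle z) ≠ 0) :
    halfAngle z ≠ 0 := fun h => hz (by rw [h, Complex.sin_zero])

theorem tendsto_taylorTerm_eulerFun :
    Tendsto (taylorTerm piHalf eulerFun) atTop (𝓝 (4 / Real.pi)) := by
  let F : ℂ → ℂ := fun z => 4 / Real.pi * (Complex.cos (halfAngle z) / sinDiv (halfAngle z))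
  have hF : DifferentiableOn ℂ F (Metric.ball 0 2) :=
    ((Complex.differentiable_cos.comp differentiable_halfAngle).differentiableOn.div
      (differentiable_sinDiv.comp differentiable_halfAngle).differentiableOn
      fun z hz => sinDiv_halfAngle_ne_zero hz).const_mul _
  have hFE : F =ᶠ[𝓝 0] fun z => (1 - z / piHalf) * eulerFun z := by
    filter_upwards [eventually_sin_halfAngle_ne] with z hz
    have h0 := halfAngle_ne_zero_of_sin_ne_zero hz
    simp only [F]
    rw [← mul_sinDiv] at hz
    rw [one_sub_div_piHalf, eulerFun, ← mul_sinDiv, mul_assoc, mul_div_assoc' (halfAngle z),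
      mul_div_mul_left _ _ h0]
  have h := tendsto_sum_taylorTerm hF norm_piHalf_lt
  simp only [sum_taylorTerm_of_eventuallyEq piHalf_ne_zero analyticAt_eulerFun hFE] at h
  simpa [F, halfAngle_piHalf, sinDiv_zero] using h

theorem tendsto_taylorTerm_balFun :
    Tendsto (fun n : ℕ => ((n + 1 : ℝ)⁻¹ : ℝ) • taylorTerm piHalf balFun n) atTop
      (𝓝 ((4 / Real.pi) ^ 2 * (balNum piHalf / 2))) := by
  let F : ℂ → ℂ := fun z => (4 / Real.pi) ^ 2 * (balNum z / (2 * sinDiv (halfAngle z) ^ 2))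
  have hF : DifferentiableOn ℂ F (Metric.ball 0 2) :=
    (differentiable_balNum.differentiableOn.div
      (((differentiable_sinDiv.comp differentiable_halfAngle).pow 2).const_mul 2).differentiableOn
      fun z hz => mul_ne_zero two_ne_zero (pow_ne_zero 2 (sinDiv_halfAngle_ne_zero hz))).const_mul _
  let G : ℂ → ℂ := fun z => (1 - z / piHalf) * balFun z
  have hG : AnalyticAt ℂ G 0 :=
    (analyticAt_const.sub (analyticAt_id.div_const)).mul analyticAt_balFun
  have hFG : F =ᶠ[𝓝 0] fun z => (1 - z / piHalf) * G z := by
    filter_upwards [eventually_sin_halfAngle_ne] with z hz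
    have h0 := halfAngle_ne_zero_of_sin_ne_zero hz
    simp only [F, G]
    rw [← mul_sinDiv] at hz
    have h1 := right_ne_zero_of_mul hz
    have := Complex.ofReal_ne_zero.2 Real.pi_ne_zero
    rw [one_sub_div_piHalf, balFun, ← mul_sinDiv]
    field_simp
  have h := tendsto_sum_taylorTerm hF norm_piHalf_lt
  simp only [sum_taylorTerm_of_eventuallyEq piHalf_ne_zero hG hFG] at h
  have h' := h.cesaro_smul.comp (tendsto_add_atTop_nat 1)
  simp only [Function.comp_def, sum_taylorTerm_of_eventuallyEq piHalf_ne_zero analyticAt_balFun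
    (EventuallyEq.refl _ G)] at h'
  simpa [F, halfAngle_piHalf, sinDiv_zero] using h'

theorem balNum_piHalf :
    balNum piHalf = (Real.pi : ℂ) ^ 2 / 8 + (Real.pi : ℂ) ^ 3 / 48 - Real.pi / 2 := by
  rw [balNum, piHalf, Complex.cos_pi_div_two, Complex.sin_pi_div_two]
  ring

end Analytic

end BalancedTrees

/-- `lim_{n→∞} b(n,1)/(n·E(n))` exists and equals `π²/24 + π/4 - 1`: for
large `n`, the probability that a uniformly random vertex of all non-plane
1-2 trees on `{1,…,n}` is balanced of rank `1` tends to `π²/24 + π/4 - 1`. -/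
theorem statement13 :
    Filter.Tendsto (fun n : ℕ => (b n 1 : ℝ) / ((n : ℝ) * (E n : ℝ)))
      Filter.atTop (nhds (Real.pi ^ 2 / 24 + Real.pi / 4 - 1)) := by
  have hπ : (Real.pi : ℂ) ≠ 0 := Complex.ofReal_ne_zero.2 Real.pi_ne_zero
  have hlim := tendsto_taylorTerm_balFun.div tendsto_taylorTerm_eulerFun
    (div_ne_zero (by norm_num) hπ)
  have hn : Filter.Tendsto (fun n : ℕ => ((((n : ℝ) + 1) / n : ℝ) : ℂ)) Filter.atTop (nhds 1) := by
    rw [← Complex.ofReal_one, Filter.tendsto_ofReal_iff]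
    simpa [add_comm] using tendsto_add_mul_div_add_mul_atTop_nhds (𝕜 := ℝ) 1 0 1 one_ne_zero
  have h := hn.mul hlim
  rw [balNum_piHalf] at h
  rw [← Filter.tendsto_ofReal_iff]
  convert h.congr' ?_ using 2
  · push_cast
    field_simp
    ring
  · filter_upwards [Filter.eventually_ge_atTop 1] with n hn
    have h1 : (n : ℂ) ≠ 0 := Nat.cast_ne_zero.2 (by omega)
    have h2 : (n + 1 : ℂ) ≠ 0 := Nat.cast_add_one_ne_zero n
    have h3 : (n.factorial : ℂ) ≠ 0 := Nat.cast_ne_zero.2 n.factorial_ne_zero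
    have h4 := pow_ne_zero n piHalf_ne_zero
    rw [Pi.div_apply, taylorTerm, taylorTerm, iteratedDeriv_balFun, iteratedDeriv_eulerFun,
      Complex.real_smul]
    push_cast
    rcases eq_or_ne (E n : ℂ) 0 with hE | hE
    · simp [hE]
    · field_simp
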